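/- (Theorem 2, generic CP4) Let M0, Λ0 ∈ ℝ, M, L ∈ ℝ^8 and Λ a real symmetric 8×8 matrix, with associated 3HDM potential V. Suppose there exists a nonzero self-aligned vector v ∈ ℝ^8 which is an eigenvector of Λ, such that each of the vectors M, L, and K^{(n)} for 1 ≤ n ≤ 7 is a real scalar multiple of v, with at least one of these vectors nonzero. If, in addition, Λ has at least four eigenvalues of multiplicity one, then V admits a CP symmetry of order 4. -/

import Mathlib

open Matrix Complex BigOperators

noncomputable section

/-- The standard Gell-Mann matrices `λ₁,…,λ₈` (indexed by `Fin 8`). -/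
def gm : Fin 8 → Matrix (Fin 3) (Fin 3) ℂ
  | 0 => !![0, 1, 0; 1, 0, 0; 0, 0, 0]
  | 1 => !![0, -I, 0; I, 0, 0; 0, 0, 0]
  | 2 => !![1, 0, 0; 0, -1, 0; 0, 0, 0]
  | 3 => !![0, 0, 1; 0, 0, 0; 1, 0, 0]
  | 4 => !![0, 0, -I; 0, 0, 0; I, 0, 0]
  | 5 => !![0, 0, 0; 0, 0, 1; 0, 1, 0]
  | 6 => !![0, 0, 0; 0, 0, -I; 0, I, 0]
  | 7 => ((Real.sqrt 3 : ℂ))⁻¹ • !![1, 0, 0; 0, 1, 0; 0, 0, -2]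

/-- `t_i = λ_i / 2`. -/
def tm (i : Fin 8) : Matrix (Fin 3) (Fin 3) ℂ := (2 : ℂ)⁻¹ • gm i

/-- The real totally antisymmetric tensor `f_{ijk} = -2i · Tr([t_i,t_j]·t_k)`. -/
def fT (i j k : Fin 8) : ℝ := ((-2 * I) * ((tm i * tm j - tm j * tm i) * tm k).trace).re

/-- The real totally symmetric tensor `d_{ijk} = 2 · Tr({t_i,t_j}·t_k)`. -/
def dT (i j k : Fin 8) : ℝ := ((2 : ℂ) * ((tm i * tm j + tm j * tm i) * tm k).trace).re

/-- Hermitian inner product on `ℂ²`. -/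
def ip (x y : Fin 2 → ℂ) : ℂ := ∑ α, (starRingEnd ℂ) (x α) * y α

/-- The bilinear `r₀(φ) = (1/√3) Σ_a ⟨φ_a, φ_a⟩`. -/
def r0 (φ : Fin 3 → Fin 2 → ℂ) : ℝ := (Real.sqrt 3)⁻¹ * (∑ a, ip (φ a) (φ a)).re

/-- The bilinears `r_i(φ) = Σ_{a,b} (t_i)_{ab} ⟨φ_a, φ_b⟩`, `i = 1,…,8`. -/
def rv (i : Fin 8) (φ : Fin 3 → Fin 2 → ℂ) : ℝ := (∑ a, ∑ b, tm i a b * ip (φ a) (φ b)).re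

/-- The general 3HDM scalar potential in the bilinear formalism. -/
def pot (M0 Λ0 : ℝ) (M L : Fin 8 → ℝ) (Λ : Matrix (Fin 8) (Fin 8) ℝ)
    (φ : Fin 3 → Fin 2 → ℂ) : ℝ :=
  M0 * r0 φ + (∑ i, M i * rv i φ) + Λ0 * (r0 φ) ^ 2 + (∑ i, L i * r0 φ * rv i φ)
    + ∑ i, ∑ j, Λ i j * rv i φ * rv j φ

/-- `V` admits a CP symmetry of order 4: a unitary `X` with `X·conj X ≠ 1`,
`(X·conj X)² = 1` and `V(X·conj φ) = V(φ)` for all `φ`. -/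
def HasCP4 (M0 Λ0 : ℝ) (M L : Fin 8 → ℝ) (Λ : Matrix (Fin 8) (Fin 8) ℝ) : Prop :=
  ∃ X : Matrix (Fin 3) (Fin 3) ℂ, X * Xᴴ = 1 ∧
    X * X.map (starRingEnd ℂ) ≠ 1 ∧ (X * X.map (starRingEnd ℂ)) ^ 2 = 1 ∧
    ∀ φ : Fin 3 → Fin 2 → ℂ,
      pot M0 Λ0 M L Λ (fun a α => ∑ b, X a b * (starRingEnd ℂ) (φ b α)) = pot M0 Λ0 M L Λ φ

/-- `K⁽ⁿ⁾_i = Σ_{j,k} d_{ijk} (Λⁿ)_{jk}`. -/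
def Kvec (Λ : Matrix (Fin 8) (Fin 8) ℝ) (n : ℕ) : Fin 8 → ℝ :=
  fun i => ∑ j, ∑ k, dT i j k * (Λ ^ n) j k

/-- The star product `(a∗b)_i = √3 Σ_{j,k} d_{ijk} a_j b_k`. -/
def starP (a b : Fin 8 → ℝ) : Fin 8 → ℝ :=
  fun i => Real.sqrt 3 * ∑ j, ∑ k, dT i j k * a j * b k

/-- A vector `v ∈ ℝ⁸` is self-aligned if `√3 Σ_{j,k} d_{ijk} v_j v_k` is a real
scalar multiple of `v`. -/
def SelfAligned (v : Fin 8 → ℝ) : Prop :=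
  ∃ c : ℝ, (fun i => Real.sqrt 3 * ∑ j, ∑ k, dT i j k * v j * v k) = c • v

/-- `u, v ∈ ℝ⁸` are f-orthogonal if `Σ_{j,k} f_{ijk} u_j v_k = 0` for all `i`. -/
def FOrth (u v : Fin 8 → ℝ) : Prop := ∀ i : Fin 8, ∑ j, ∑ k, fT i j k * u j * v k = 0

/-- The canonical order-4 CP matrix `X = [[0,1,0],[-1,0,0],[0,0,1]]`. -/
def Xcp4 : Matrix (Fin 3) (Fin 3) ℂ := !![0, 1, 0; -1, 0, 0; 0, 0, 1]

lemma inv_sqrt_three : (√3)⁻¹ = √3 * (1 / 3) := by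
  have h : √3 * √3 = 3 := Real.mul_self_sqrt (by norm_num)
  have h0 : √3 ≠ 0 := by positivity
  field_simp
  linarith

lemma dT_zero (j k : Fin 8) : dT 0 j k =
    (!![0,0,0,0,0,0,0,(√3)⁻¹; 0,0,0,0,0,0,0,0; 0,0,0,0,0,0,0,0; 0,0,0,0,0,1/2,0,0;
      0,0,0,0,0,0,1/2,0; 0,0,0,1/2,0,0,0,0; 0,0,0,0,1/2,0,0,0; (√3)⁻¹,0,0,0,0,0,0,0] :
      Matrix (Fin 8) (Fin 8) ℝ) j k := by
  rw [inv_sqrt_three]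
  fin_cases j <;> fin_cases k <;>
    simp [dT, tm, gm, Matrix.trace, Fin.sum_univ_three] <;> ring_nf

lemma dT_one (j k : Fin 8) : dT 1 j k =
    (!![0,0,0,0,0,0,0,0; 0,0,0,0,0,0,0,(√3)⁻¹; 0,0,0,0,0,0,0,0; 0,0,0,0,0,0,-1/2,0;
      0,0,0,0,0,1/2,0,0; 0,0,0,0,1/2,0,0,0; 0,0,0,-1/2,0,0,0,0; 0,(√3)⁻¹,0,0,0,0,0,0] :
      Matrix (Fin 8) (Fin 8) ℝ) j k := by
  rw [inv_sqrt_three]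
  fin_cases j <;> fin_cases k <;>
    simp [dT, tm, gm, Matrix.trace, Fin.sum_univ_three] <;> ring_nf

lemma dT_two (j k : Fin 8) : dT 2 j k =
    (!![0,0,0,0,0,0,0,0; 0,0,0,0,0,0,0,0; 0,0,0,0,0,0,0,(√3)⁻¹; 0,0,0,1/2,0,0,0,0;
      0,0,0,0,1/2,0,0,0; 0,0,0,0,0,-1/2,0,0; 0,0,0,0,0,0,-1/2,0; 0,0,(√3)⁻¹,0,0,0,0,0] :
      Matrix (Fin 8) (Fin 8) ℝ) j k := by
  rw [inv_sqrt_three]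
  fin_cases j <;> fin_cases k <;>
    simp [dT, tm, gm, Matrix.trace, Fin.sum_univ_three] <;> ring_nf

/-- Contraction of the symmetric tensor `d` with a matrix. -/
def dContract (S : Matrix (Fin 8) (Fin 8) ℝ) (i : Fin 8) : ℝ := ∑ j, ∑ k, dT i j k * S j k

lemma dContract_zero (S : Matrix (Fin 8) (Fin 8) ℝ) : dContract S 0 =
    (√3)⁻¹ * (S 0 7 + S 7 0) + (S 3 5 + S 5 3 + S 4 6 + S 6 4) / 2 := by
  simp [dContract, dT_zero, Fin.sum_univ_eight]; ring

lemma dContract_one (S : Matrix (Fin 8) (Fin 8) ℝ) : dContract S 1 =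
    (√3)⁻¹ * (S 1 7 + S 7 1) + (S 4 5 + S 5 4 - S 3 6 - S 6 3) / 2 := by
  simp [dContract, dT_one, Fin.sum_univ_eight]; ring

lemma dContract_two (S : Matrix (Fin 8) (Fin 8) ℝ) : dContract S 2 =
    (√3)⁻¹ * (S 2 7 + S 7 2) + (S 3 3 + S 4 4 - S 5 5 - S 6 6) / 2 := by
  simp [dContract, dT_two, Fin.sum_univ_eight]; ring

lemma two_trace_tm_mul_tm (i j : Fin 8) :
    2 * ((tm i * tm j).trace).re = (1 : Matrix (Fin 8) (Fin 8) ℝ) i j := by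
  fin_cases i <;> fin_cases j <;>
    simp [tm, gm, Matrix.trace, Fin.sum_univ_three] <;> norm_num
  ring_nf
  norm_num

lemma sum_smul_tm (c : Fin 8 → ℂ) : ∑ i, c i • tm i = (2 : ℂ)⁻¹ •
    !![c 2 + c 7 * (√3 : ℂ)⁻¹, c 0 - I * c 1, c 3 - I * c 4;
      c 0 + I * c 1, -c 2 + c 7 * (√3 : ℂ)⁻¹, c 5 - I * c 6;
      c 3 + I * c 4, c 5 + I * c 6, -2 * c 7 * (√3 : ℂ)⁻¹] := by
  ext a b
  fin_cases a <;> fin_cases b <;> simp [Fin.sum_univ_eight, tm, gm] <;> ring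

lemma trace_tm_mul (H : Matrix (Fin 3) (Fin 3) ℂ) (i : Fin 8) :
    (tm i * H).trace = (2 : ℂ)⁻¹ * ![H 1 0 + H 0 1, I * (H 0 1 - H 1 0), H 0 0 - H 1 1,
      H 2 0 + H 0 2, I * (H 0 2 - H 2 0), H 2 1 + H 1 2, I * (H 1 2 - H 2 1),
      (√3 : ℂ)⁻¹ * (H 0 0 + H 1 1 - 2 * H 2 2)] i := by
  fin_cases i <;>
    simp [tm, gm, Matrix.trace, Fin.sum_univ_three, Matrix.vecMul, dotProduct] <;> ring

lemma sum_trace_smul_tm {H : Matrix (Fin 3) (Fin 3) ℂ} (htr : H.trace = 0) :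
    ∑ i, (2 * (tm i * H).trace) • tm i = H := by
  simp only [Matrix.trace, Fin.sum_univ_three, Matrix.diag] at htr
  have h3 : (√3 : ℂ)⁻¹ ^ 2 = 1 / 3 := by
    rw [inv_pow, ← ofReal_pow, Real.sq_sqrt (by norm_num)]; norm_num
  rw [sum_smul_tm]
  simp only [trace_tm_mul]
  ext a b
  fin_cases a <;> fin_cases b <;> simp <;> ring_nf <;> simp only [h3, I_sq] <;>
    first | (ring; done) | linear_combination (-1 / 3) * htr

lemma tm_isHermitian (i : Fin 8) : (tm i).IsHermitian := by
  ext a b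
  fin_cases i <;> fin_cases a <;> fin_cases b <;> simp [tm, gm]

lemma trace_tm (i : Fin 8) : (tm i).trace = 0 := by
  fin_cases i <;> simp [tm, gm, Matrix.trace, Fin.sum_univ_three]
  ring

lemma ofReal_re_trace_mul {A B : Matrix (Fin 3) (Fin 3) ℂ} (hA : A.IsHermitian)
    (hB : B.IsHermitian) : ((A * B).trace.re : ℂ) = (A * B).trace := by
  rw [← conj_eq_iff_re, ← Complex.star_def, ← Matrix.trace_conjTranspose,
    Matrix.conjTranspose_mul, hA.eq, hB.eq, Matrix.trace_mul_comm]

/-- Coordinates of a matrix in the basis `t_i`. -/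
def tCoord (H : Matrix (Fin 3) (Fin 3) ℂ) (i : Fin 8) : ℝ := 2 * (tm i * H).trace.re

lemma sum_tCoord_smul_tm {H : Matrix (Fin 3) (Fin 3) ℂ} (hH : H.IsHermitian)
    (htr : H.trace = 0) : ∑ i, (tCoord H i : ℂ) • tm i = H := by
  conv_rhs => rw [← sum_trace_smul_tm htr]
  refine Finset.sum_congr rfl fun i _ => ?_
  rw [tCoord, ofReal_mul, ofReal_re_trace_mul (tm_isHermitian i) hH]
  simp

lemma tCoord_sum_smul_tm (a : Fin 8 → ℝ) : tCoord (∑ i, (a i : ℂ) • tm i) = a := by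
  ext i
  simp only [tCoord, Matrix.mul_smul, Matrix.trace_sum, Matrix.trace_smul,
    re_sum, smul_eq_mul, re_ofReal_mul, Finset.mul_sum]
  rw [Finset.sum_congr rfl fun j _ => show 2 * (a j * ((tm i * tm j).trace).re) =
    (1 : Matrix (Fin 8) (Fin 8) ℝ) i j * a j by rw [← two_trace_tm_mul_tm]; ring]
  exact congrFun (Matrix.one_mulVec a) i

/-- `2 Re Tr(A B)` for traceless Hermitian `A`, in coordinates. -/
lemma two_re_trace_mul {A : Matrix (Fin 3) (Fin 3) ℂ} (hA : A.IsHermitian)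
    (htr : A.trace = 0) (B : Matrix (Fin 3) (Fin 3) ℂ) :
    2 * (A * B).trace.re = ∑ i, tCoord A i * tCoord B i := by
  conv_lhs => rw [← sum_tCoord_smul_tm hA htr]
  simp only [Matrix.sum_mul, Matrix.smul_mul, Matrix.trace_sum, Matrix.trace_smul,
    re_sum, smul_eq_mul, re_ofReal_mul, Finset.mul_sum]
  refine Finset.sum_congr rfl fun i _ => ?_
  conv_rhs => rw [tCoord.eq_def B]
  ring

/-- The adjoint action of a unitary matrix on `ℝ⁸`. -/
def adMat (U : Matrix (Fin 3) (Fin 3) ℂ) : Matrix (Fin 8) (Fin 8) ℝ :=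
  Matrix.of fun i j => tCoord (U * tm j * Uᴴ) i

lemma isHermitian_conj_tm (U : Matrix (Fin 3) (Fin 3) ℂ) (i : Fin 8) :
    (U * tm i * Uᴴ).IsHermitian :=
  Matrix.isHermitian_mul_mul_conjTranspose U (tm_isHermitian i)

lemma trace_conj_tm {U : Matrix (Fin 3) (Fin 3) ℂ} (hU : Uᴴ * U = 1) (i : Fin 8) :
    (U * tm i * Uᴴ).trace = 0 := by
  rw [Matrix.trace_mul_comm, ← Matrix.mul_assoc, hU, Matrix.one_mul, trace_tm]

lemma sum_adMat_smul_tm {U : Matrix (Fin 3) (Fin 3) ℂ} (hU : Uᴴ * U = 1) (j : Fin 8) :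
    ∑ i, (adMat U i j : ℂ) • tm i = U * tm j * Uᴴ :=
  sum_tCoord_smul_tm (isHermitian_conj_tm U j) (trace_conj_tm hU j)

lemma sum_adMat_smul_tm' {U : Matrix (Fin 3) (Fin 3) ℂ} (hU : U * Uᴴ = 1) (i : Fin 8) :
    ∑ j, (adMat U i j : ℂ) • tm j = Uᴴ * tm i * U := by
  have h := sum_tCoord_smul_tm (H := Uᴴ * tm i * U)
    (by simpa using isHermitian_conj_tm Uᴴ i)
    (by simpa using trace_conj_tm (U := Uᴴ) (by simpa using hU) i)
  rw [← h]
  refine Finset.sum_congr rfl fun j _ => ?_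
  have hc : (tm i * (U * tm j * Uᴴ)).trace = (tm j * (Uᴴ * tm i * U)).trace := by
    rw [← Matrix.mul_assoc, Matrix.trace_mul_comm, Matrix.trace_mul_comm (tm j)]
    simp only [Matrix.mul_assoc]
  rw [adMat, Matrix.of_apply, tCoord, tCoord, hc]

lemma adMat_transpose_mul {U : Matrix (Fin 3) (Fin 3) ℂ} (hU : Uᴴ * U = 1) :
    (adMat U)ᵀ * adMat U = 1 := by
  ext j k
  rw [Matrix.mul_apply]
  simp only [Matrix.transpose_apply, adMat, Matrix.of_apply]
  rw [← two_re_trace_mul (isHermitian_conj_tm U j) (trace_conj_tm hU j),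
    ← two_trace_tm_mul_tm, show U * tm j * Uᴴ * (U * tm k * Uᴴ) = U * (tm j * (Uᴴ * U) * tm k * Uᴴ)
      by simp only [Matrix.mul_assoc], hU, Matrix.trace_mul_comm]
  simp only [Matrix.mul_assoc, hU, Matrix.mul_one]

/-- The vector of bilinears `(r₁,…,r₈)`. -/
def rVec (φ : Fin 3 → Fin 2 → ℂ) : Fin 8 → ℝ := fun i => rv i φ

lemma pot_eq (M0 Λ0 : ℝ) (M L : Fin 8 → ℝ) (Λ : Matrix (Fin 8) (Fin 8) ℝ)
    (φ : Fin 3 → Fin 2 → ℂ) : pot M0 Λ0 M L Λ φ = M0 * r0 φ + M ⬝ᵥ rVec φ + Λ0 * (r0 φ) ^ 2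
      + r0 φ * (L ⬝ᵥ rVec φ) + rVec φ ⬝ᵥ Λ *ᵥ rVec φ := by
  simp only [pot, dotProduct, mulVec, rVec, Finset.mul_sum]
  congr 1
  · congr 1
    exact Finset.sum_congr rfl fun i _ => by ring
  · exact Finset.sum_congr rfl fun i _ => Finset.sum_congr rfl fun j _ => by ring

/-- The action of a `3 × 3` matrix on field configurations. -/
def matAct (U : Matrix (Fin 3) (Fin 3) ℂ) (φ : Fin 3 → Fin 2 → ℂ) : Fin 3 → Fin 2 → ℂ :=
  fun a α => ∑ b, U a b * φ b α

/-- Complex conjugation of a field configuration. -/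
def conjField (φ : Fin 3 → Fin 2 → ℂ) : Fin 3 → Fin 2 → ℂ :=
  fun a α => (starRingEnd ℂ) (φ a α)

lemma matAct_eq_mul (U : Matrix (Fin 3) (Fin 3) ℂ) (φ : Fin 3 → Fin 2 → ℂ) :
    matAct U φ = U * Matrix.of φ := rfl

lemma matAct_mul (U V : Matrix (Fin 3) (Fin 3) ℂ) (φ : Fin 3 → Fin 2 → ℂ) :
    matAct (U * V) φ = matAct U (matAct V φ) := by
  simp only [matAct_eq_mul, Matrix.mul_assoc]
  rfl

lemma matAct_one (φ : Fin 3 → Fin 2 → ℂ) : matAct 1 φ = φ := by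
  rw [matAct_eq_mul, Matrix.one_mul]
  rfl

lemma conjField_matAct (U : Matrix (Fin 3) (Fin 3) ℂ) (φ : Fin 3 → Fin 2 → ℂ) :
    conjField (matAct U φ) = matAct (U.map (starRingEnd ℂ)) (conjField φ) := by
  ext a α
  simp [conjField, matAct]

/-- The (transposed) Gram matrix of a field configuration. -/
def gramMat (φ : Fin 3 → Fin 2 → ℂ) : Matrix (Fin 3) (Fin 3) ℂ := Matrix.of φ * (Matrix.of φ)ᴴ

lemma gramMat_apply (φ : Fin 3 → Fin 2 → ℂ) (a b : Fin 3) : gramMat φ a b = ip (φ b) (φ a) := by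
  simp [gramMat, ip, Matrix.mul_apply, mul_comm]

lemma gramMat_matAct (U : Matrix (Fin 3) (Fin 3) ℂ) (φ : Fin 3 → Fin 2 → ℂ) :
    gramMat (matAct U φ) = U * gramMat φ * Uᴴ := by
  rw [gramMat, gramMat, matAct_eq_mul]
  change U * Matrix.of φ * (U * Matrix.of φ)ᴴ = _
  simp only [Matrix.conjTranspose_mul, Matrix.mul_assoc]

lemma rv_eq (i : Fin 8) (φ : Fin 3 → Fin 2 → ℂ) : rv i φ = (tm i * gramMat φ).trace.re := by
  simp only [rv, Matrix.trace, Matrix.diag, Matrix.mul_apply, gramMat_apply]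

lemma r0_eq (φ : Fin 3 → Fin 2 → ℂ) : r0 φ = (√3)⁻¹ * (gramMat φ).trace.re := by
  simp only [r0, Matrix.trace, Matrix.diag, gramMat_apply]

lemma r0_matAct {U : Matrix (Fin 3) (Fin 3) ℂ} (hU : Uᴴ * U = 1) (φ : Fin 3 → Fin 2 → ℂ) :
    r0 (matAct U φ) = r0 φ := by
  rw [r0_eq, r0_eq, gramMat_matAct, Matrix.trace_mul_comm, ← Matrix.mul_assoc, hU, Matrix.one_mul]

lemma rVec_matAct {U : Matrix (Fin 3) (Fin 3) ℂ} (hU : U * Uᴴ = 1) (φ : Fin 3 → Fin 2 → ℂ) :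
    rVec (matAct U φ) = adMat U *ᵥ rVec φ := by
  ext i
  have hc : (tm i * (U * gramMat φ * Uᴴ)).trace = ((Uᴴ * tm i * U) * gramMat φ).trace := by
    rw [← Matrix.mul_assoc, Matrix.trace_mul_comm]
    simp only [Matrix.mul_assoc]
  simp only [rVec, mulVec, dotProduct, rv_eq]
  rw [gramMat_matAct, hc, ← sum_adMat_smul_tm' hU]
  simp only [Matrix.sum_mul, Matrix.smul_mul, Matrix.trace_sum, Matrix.trace_smul,
    re_sum, smul_eq_mul, re_ofReal_mul]

lemma pot_matAct {U : Matrix (Fin 3) (Fin 3) ℂ} (hU : U * Uᴴ = 1) (M0 Λ0 : ℝ)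
    (M L : Fin 8 → ℝ) (Λ : Matrix (Fin 8) (Fin 8) ℝ) (φ : Fin 3 → Fin 2 → ℂ) :
    pot M0 Λ0 M L Λ (matAct U φ) = pot M0 Λ0 ((adMat U)ᵀ *ᵥ M) ((adMat U)ᵀ *ᵥ L)
      ((adMat U)ᵀ * Λ * adMat U) φ := by
  have ht (x y : Fin 8 → ℝ) : x ⬝ᵥ adMat U *ᵥ y = ((adMat U)ᵀ *ᵥ x) ⬝ᵥ y := by
    rw [Matrix.mulVec_transpose, Matrix.dotProduct_mulVec]
  have hq (x : Fin 8 → ℝ) : (adMat U *ᵥ x) ⬝ᵥ Λ *ᵥ (adMat U *ᵥ x) =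
      x ⬝ᵥ ((adMat U)ᵀ * Λ * adMat U) *ᵥ x := by
    rw [dotProduct_comm, ht, dotProduct_comm, Matrix.mulVec_mulVec, Matrix.mulVec_mulVec,
      Matrix.mul_assoc]
  rw [pot_eq, pot_eq, r0_matAct (mul_eq_one_comm.mp hU), rVec_matAct hU, ht, ht, hq]

lemma HasCP4.of_adMat {U : Matrix (Fin 3) (Fin 3) ℂ} (hU : U * Uᴴ = 1) {M0 Λ0 : ℝ}
    {M L : Fin 8 → ℝ} {Λ : Matrix (Fin 8) (Fin 8) ℝ}
    (h : HasCP4 M0 Λ0 ((adMat U)ᵀ *ᵥ M) ((adMat U)ᵀ *ᵥ L) ((adMat U)ᵀ * Λ * adMat U)) :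
    HasCP4 M0 Λ0 M L Λ := by
  obtain ⟨X, hX, hX1, hX2, hV⟩ := h
  have hU' : Uᴴ * U = 1 := mul_eq_one_comm.mp hU
  have hUt : Uᵀ * U.map (starRingEnd ℂ) = 1 := by
    have := congrArg Matrix.transpose hU'
    rwa [Matrix.transpose_mul, Matrix.transpose_one] at this
  have hUt' : U.map (starRingEnd ℂ) * Uᵀ = 1 := mul_eq_one_comm.mp hUt
  have hconj : (U * X * Uᵀ) * (U * X * Uᵀ).map (starRingEnd ℂ)
      = U * (X * X.map (starRingEnd ℂ)) * Uᴴ := by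
    rw [Matrix.map_mul, Matrix.map_mul,
      show Uᵀ.map (starRingEnd ℂ) = Uᴴ from rfl]
    calc _ = U * X * (Uᵀ * U.map (starRingEnd ℂ)) * X.map (starRingEnd ℂ) * Uᴴ := by
          simp only [Matrix.mul_assoc]
      _ = _ := by rw [hUt]; simp only [Matrix.mul_assoc, Matrix.one_mul]
  refine ⟨U * X * Uᵀ, ?_, ?_, ?_, fun φ => ?_⟩
  · rw [Matrix.conjTranspose_mul, Matrix.conjTranspose_mul]
    calc _ = U * X * (Uᵀ * Uᵀᴴ) * Xᴴ * Uᴴ := by simp only [Matrix.mul_assoc]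
      _ = U * (X * Xᴴ) * Uᴴ := by
        rw [show Uᵀᴴ = U.map (starRingEnd ℂ) from rfl, hUt]
        simp only [Matrix.mul_assoc, Matrix.one_mul]
      _ = 1 := by rw [hX, Matrix.mul_one, hU]
  · intro h1
    rw [hconj] at h1
    apply hX1
    calc _ = (Uᴴ * U) * (X * X.map (starRingEnd ℂ)) * (Uᴴ * U) := by
          rw [hU', Matrix.one_mul, Matrix.mul_one]
      _ = Uᴴ * (U * (X * X.map (starRingEnd ℂ)) * Uᴴ) * U := by simp only [Matrix.mul_assoc]
      _ = 1 := by rw [h1, Matrix.mul_one, hU']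
  · rw [hconj, pow_two] at *
    generalize X * X.map (starRingEnd ℂ) = Y at *
    calc _ = U * Y * (Uᴴ * U) * Y * Uᴴ := by simp only [Matrix.mul_assoc]
      _ = U * (Y * Y) * Uᴴ := by rw [hU']; simp only [Matrix.mul_assoc, Matrix.one_mul]
      _ = 1 := by rw [hX2, Matrix.mul_one, hU]
  · change pot M0 Λ0 M L Λ (matAct (U * X * Uᵀ) (conjField φ)) = _
    have h1 : φ = matAct U (matAct Uᴴ φ) := by rw [← matAct_mul, hU, matAct_one]
    have h2 := hV (matAct Uᴴ φ)
    rw [← pot_matAct hU, ← pot_matAct hU, ← h1] at h2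
    rw [← h2, Matrix.mul_assoc, matAct_mul, matAct_mul]
    congr 2
    change _ = matAct X (conjField (matAct Uᴴ φ))
    rw [conjField_matAct]
    congr 2
    ext a b
    simp

lemma dT_eq (i j k : Fin 8) : dT i j k = 2 * (tm i * (tm j * tm k + tm k * tm j)).trace.re := by
  have h : (tm i * (tm j * tm k + tm k * tm j)).trace =
      ((tm i * tm j + tm j * tm i) * tm k).trace := by
    rw [Matrix.mul_add, Matrix.add_mul, Matrix.trace_add, Matrix.trace_add,
      ← Matrix.mul_assoc, ← Matrix.mul_assoc, Matrix.trace_mul_comm _ (tm j)]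
    simp only [Matrix.mul_assoc]
  rw [h, dT]
  simp

/-- The matrix `Σ S_{jk} {t_j, t_k}`. -/
def anticommSum (S : Matrix (Fin 8) (Fin 8) ℝ) : Matrix (Fin 3) (Fin 3) ℂ :=
  ∑ j, ∑ k, (S j k : ℂ) • (tm j * tm k + tm k * tm j)

lemma tCoord_anticommSum (S : Matrix (Fin 8) (Fin 8) ℝ) :
    tCoord (anticommSum S) = dContract S := by
  ext i
  simp only [tCoord, anticommSum, dContract, Matrix.mul_smul, Matrix.trace_sum,
    Matrix.trace_smul, re_sum, smul_eq_mul, re_ofReal_mul, Finset.mul_sum, dT_eq]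
  exact Finset.sum_congr rfl fun j _ => Finset.sum_congr rfl fun k _ => by ring

lemma anticommSum_mul_mul (P S : Matrix (Fin 8) (Fin 8) ℝ) :
    anticommSum (Pᵀ * S * P) = ∑ p, ∑ q, (S p q : ℂ) •
      ((∑ j, (P p j : ℂ) • tm j) * (∑ j, (P q j : ℂ) • tm j) +
        (∑ j, (P q j : ℂ) • tm j) * (∑ j, (P p j : ℂ) • tm j)) := by
  have he (p q : Fin 8) : (∑ j, (P p j : ℂ) • tm j) * (∑ j, (P q j : ℂ) • tm j) +
      (∑ j, (P q j : ℂ) • tm j) * (∑ j, (P p j : ℂ) • tm j) =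
      ∑ j, ∑ k, ((P p j * P q k : ℝ) : ℂ) • (tm j * tm k + tm k * tm j) := by
    simp only [smul_add, Finset.sum_add_distrib]
    congr 1
    · simp only [Finset.sum_mul_sum, Matrix.smul_mul, Matrix.mul_smul, smul_smul, ofReal_mul]
      exact Finset.sum_congr rfl fun j _ => Finset.sum_congr rfl fun k _ => by
        rw [mul_comm (P q k : ℂ)]
    · rw [Finset.sum_mul_sum, Finset.sum_comm]
      simp only [Matrix.smul_mul, Matrix.mul_smul, smul_smul, ofReal_mul]
  simp only [he]
  simp only [anticommSum, Matrix.mul_apply, Matrix.transpose_apply, Finset.sum_mul, ofReal_sum,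
    Finset.sum_smul, Finset.smul_sum, smul_smul]
  calc _ = ∑ j, ∑ q, ∑ p, ∑ k, ((P p j * S p q * P q k : ℝ) : ℂ) •
          (tm j * tm k + tm k * tm j) := by
        refine Finset.sum_congr rfl fun j _ => ?_
        rw [Finset.sum_comm]
        exact Finset.sum_congr rfl fun q _ => Finset.sum_comm
    _ = ∑ q, ∑ p, ∑ j, ∑ k, ((P p j * S p q * P q k : ℝ) : ℂ) •
          (tm j * tm k + tm k * tm j) := by
        rw [Finset.sum_comm]
        exact Finset.sum_congr rfl fun q _ => Finset.sum_comm
    _ = _ := by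
        rw [Finset.sum_comm]
        refine Finset.sum_congr rfl fun p _ => Finset.sum_congr rfl fun q _ =>
          Finset.sum_congr rfl fun j _ => Finset.sum_congr rfl fun k _ => ?_
        congr 1
        push_cast
        ring

lemma dContract_conj {U : Matrix (Fin 3) (Fin 3) ℂ} (hU : U * Uᴴ = 1)
    (S : Matrix (Fin 8) (Fin 8) ℝ) :
    dContract ((adMat U)ᵀ * S * adMat U) = (adMat U)ᵀ *ᵥ dContract S := by
  have hW : anticommSum ((adMat U)ᵀ * S * adMat U) = Uᴴ * anticommSum S * U := by
    rw [anticommSum_mul_mul]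
    simp only [sum_adMat_smul_tm' hU]
    simp only [anticommSum, Matrix.mul_sum, Matrix.sum_mul, Matrix.mul_smul, Matrix.smul_mul]
    refine Finset.sum_congr rfl fun p _ => Finset.sum_congr rfl fun q _ => ?_
    have h (x y : Matrix (Fin 3) (Fin 3) ℂ) : Uᴴ * x * U * (Uᴴ * y * U) = Uᴴ * (x * y) * U := by
      calc _ = Uᴴ * x * (U * Uᴴ) * y * U := by simp only [Matrix.mul_assoc]
        _ = _ := by rw [hU, Matrix.mul_one]; simp only [Matrix.mul_assoc]
    rw [h, h, Matrix.mul_add, Matrix.add_mul]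
  ext i
  have hc : (tm i * (Uᴴ * anticommSum S * U)).trace = (U * tm i * Uᴴ * anticommSum S).trace := by
    rw [← Matrix.mul_assoc, Matrix.trace_mul_comm]
    simp only [Matrix.mul_assoc]
  rw [← tCoord_anticommSum, hW, tCoord, hc, ← sum_adMat_smul_tm (mul_eq_one_comm.mp hU),
    ← tCoord_anticommSum]
  simp only [Matrix.sum_mul, Matrix.smul_mul, Matrix.trace_sum, Matrix.trace_smul,
    re_sum, smul_eq_mul, re_ofReal_mul, Finset.mul_sum, mulVec, dotProduct, tCoord,
    Matrix.transpose_apply]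
  exact Finset.sum_congr rfl fun j _ => by ring

lemma Kvec_eq (Λ : Matrix (Fin 8) (Fin 8) ℝ) (n : ℕ) : Kvec Λ n = dContract (Λ ^ n) := rfl

lemma adMat_mul_transpose {U : Matrix (Fin 3) (Fin 3) ℂ} (hU : U * Uᴴ = 1) :
    adMat U * (adMat U)ᵀ = 1 :=
  mul_eq_one_comm.mp (adMat_transpose_mul (mul_eq_one_comm.mp hU))

lemma Kvec_conj {U : Matrix (Fin 3) (Fin 3) ℂ} (hU : U * Uᴴ = 1)
    (Λ : Matrix (Fin 8) (Fin 8) ℝ) (n : ℕ) :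
    Kvec ((adMat U)ᵀ * Λ * adMat U) n = (adMat U)ᵀ *ᵥ Kvec Λ n := by
  have hO := adMat_mul_transpose hU
  have hp : ((adMat U)ᵀ * Λ * adMat U) ^ n = (adMat U)ᵀ * Λ ^ n * adMat U := by
    induction n with
    | zero => simp [mul_eq_one_comm.mp hO]
    | succ n ih =>
      rw [pow_succ, ih, pow_succ]
      calc _ = (adMat U)ᵀ * Λ ^ n * (adMat U * (adMat U)ᵀ) * Λ * adMat U := by
            simp only [Matrix.mul_assoc]
        _ = _ := by rw [hO, Matrix.mul_one]; simp only [Matrix.mul_assoc]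
  rw [Kvec_eq, Kvec_eq, hp, dContract_conj hU]

lemma exists_unitary_conj_diagonal {V : Matrix (Fin 3) (Fin 3) ℂ} (hV : V.IsHermitian)
    (htr : V.trace = 0) {k β : ℂ} (hsq : V * V = k • 1 + β • V) :
    ∃ U : Matrix (Fin 3) (Fin 3) ℂ, ∃ a : ℝ, U * Uᴴ = 1 ∧
      Uᴴ * V * U = (a : ℂ) • Matrix.diagonal ![1, 1, -2] := by
  obtain ⟨W, d, hW, hd⟩ : ∃ W : Matrix (Fin 3) (Fin 3) ℂ, ∃ d : Fin 3 → ℝ, W * Wᴴ = 1 ∧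
      Wᴴ * V * W = Matrix.diagonal fun i => (d i : ℂ) := by
    refine ⟨hV.eigenvectorUnitary, hV.eigenvalues, ?_, ?_⟩
    · exact Matrix.mem_unitaryGroup_iff.mp hV.eigenvectorUnitary.2
    · have := hV.conjStarAlgAut_star_eigenvectorUnitary
      rw [Unitary.conjStarAlgAut_star_apply] at this
      exact this
  have hW' : Wᴴ * W = 1 := mul_eq_one_comm.mp hW
  have hroot (i : Fin 3) : (d i : ℂ) * d i = k + β * d i := by
    have h1 : (Wᴴ * V * W) * (Wᴴ * V * W) = k • 1 + β • (Wᴴ * V * W) := by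
      calc _ = Wᴴ * (V * (W * Wᴴ) * V) * W := by simp only [Matrix.mul_assoc]
        _ = _ := by
          rw [hW, Matrix.mul_one, hsq, Matrix.mul_add, Matrix.add_mul, Matrix.mul_smul,
            Matrix.mul_one, Matrix.smul_mul, hW', Matrix.mul_smul, Matrix.smul_mul]
    rw [hd, Matrix.diagonal_mul_diagonal] at h1
    simpa using congrFun (congrFun h1 i) i
  have hsum : d 0 + d 1 + d 2 = 0 := by
    have h1 : (Wᴴ * V * W).trace = 0 := by
      rw [Matrix.trace_mul_comm, ← Matrix.mul_assoc, hW, Matrix.one_mul, htr]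
    rw [hd, Matrix.trace_diagonal, Fin.sum_univ_three] at h1
    exact_mod_cast h1
  have hperm : ∃ σ : Equiv.Perm (Fin 3), d (σ 0) = d (σ 1) := by
    by_cases h01 : d 0 = d 1
    · exact ⟨1, h01⟩
    by_cases h02 : d 0 = d 2
    · exact ⟨Equiv.swap 1 2, by simpa [Equiv.swap_apply_of_ne_of_ne] using h02⟩
    have e1 : (d 0 : ℂ) + d 1 = β :=
      mul_left_cancel₀ (sub_ne_zero.mpr (ofReal_injective.ne h01))
        (by linear_combination hroot 0 - hroot 1)
    have e2 : (d 0 : ℂ) + d 2 = β :=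
      mul_left_cancel₀ (sub_ne_zero.mpr (ofReal_injective.ne h02))
        (by linear_combination hroot 0 - hroot 2)
    refine ⟨Equiv.swap 0 2, ?_⟩
    have : (d 2 : ℂ) = d 1 := by linear_combination e2 - e1
    simpa [Equiv.swap_apply_of_ne_of_ne] using ofReal_injective this
  obtain ⟨σ, hσ⟩ := hperm
  refine ⟨W.submatrix id σ, d (σ 0), ?_, ?_⟩
  · rw [Matrix.conjTranspose_submatrix, Matrix.submatrix_mul_equiv, hW]
    simp
  · have h2 : (W.submatrix id σ)ᴴ * V * W.submatrix id σ = (Wᴴ * V * W).submatrix σ σ := by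
      ext i j
      simp [Matrix.mul_apply]
    have h3 : d (σ 2) = -2 * d (σ 0) := by
      have : ∑ i, d (σ i) = ∑ i, d i := Equiv.sum_comp σ d
      rw [Fin.sum_univ_three, Fin.sum_univ_three] at this
      linarith
    rw [h2, hd]
    ext i j
    fin_cases i <;> fin_cases j <;> simp [hσ, h3, mul_comm]

lemma SelfAligned.exists_sq_eq {v : Fin 8 → ℝ} (h : SelfAligned v) : ∃ k β : ℂ,
    (∑ i, (v i : ℂ) • tm i) * (∑ i, (v i : ℂ) • tm i) = k • 1 + β • ∑ i, (v i : ℂ) • tm i := by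
  obtain ⟨c, hc⟩ := h
  set V := ∑ i, (v i : ℂ) • tm i with hV
  have hVh : V.IsHermitian := by
    simp [Matrix.IsHermitian, hV, Matrix.conjTranspose_sum, (tm_isHermitian _).eq]
  have h3 : (√3 : ℝ) ≠ 0 := by positivity
  have hT : tCoord (V * V) = (c / (2 * √3)) • v := by
    ext i
    have h1 := congrFun hc i
    have h2 : (√3 * ∑ j, ∑ k, dT i j k * v j * v k) = √3 * (2 * tCoord (V * V) i) := by
      congr 1
      have : (V * V) = ∑ j, ∑ k, ((v j * v k : ℝ) : ℂ) • (tm j * tm k) := by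
        rw [hV, Finset.sum_mul_sum]
        simp only [Matrix.smul_mul, Matrix.mul_smul, smul_smul, ofReal_mul]
        exact Finset.sum_congr rfl fun j _ => Finset.sum_congr rfl fun k _ => by
          rw [mul_comm (v k : ℂ)]
      have h4 : V * V + V * V = anticommSum (Matrix.vecMulVec v v) := by
        rw [anticommSum]
        simp only [smul_add, Finset.sum_add_distrib, Matrix.vecMulVec_apply]
        congr 1
        rw [Finset.sum_comm]
        simpa only [mul_comm] using this
      have h5 := congrFun (tCoord_anticommSum (Matrix.vecMulVec v v)) i
      rw [← h4, tCoord, Matrix.mul_add, Matrix.trace_add, add_re] at h5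
      simp only [dContract, Matrix.vecMulVec_apply] at h5
      simp only [mul_assoc (dT _ _ _)]
      rw [← h5, tCoord]
      ring
    rw [h2] at h1
    simp only [Pi.smul_apply, smul_eq_mul] at h1 ⊢
    field_simp
    linarith
  have hVV : (V * V).IsHermitian := by simp [Matrix.IsHermitian, hVh.eq]
  refine ⟨((V * V).trace.re / 3 : ℝ), (c / (2 * √3) : ℝ), ?_⟩
  have htre : ((V * V).trace.re : ℂ) = (V * V).trace := ofReal_re_trace_mul hVh hVh
  set D := V * V - (((V * V).trace.re / 3 : ℝ) : ℂ) • (1 : Matrix (Fin 3) (Fin 3) ℂ) with hD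
  have hDh : D.IsHermitian := by
    rw [Matrix.IsHermitian, hD, Matrix.conjTranspose_sub, hVV.eq, Matrix.conjTranspose_smul]
    simp
  have hDt : D.trace = 0 := by
    rw [hD, Matrix.trace_sub, Matrix.trace_smul, Matrix.trace_one, ofReal_div, htre]
    simp
  have hDc : tCoord D = tCoord (V * V) := by
    ext i
    simp [tCoord, hD, Matrix.mul_sub, trace_tm]
  have h6 := sum_tCoord_smul_tm hDh hDt
  rw [hDc, hT] at h6
  rw [← sub_eq_iff_eq_add', ← hD, ← h6, hV, Finset.smul_sum]
  simp [mul_smul]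

lemma SelfAligned.exists_adMat {v : Fin 8 → ℝ} (hsa : SelfAligned v) :
    ∃ U : Matrix (Fin 3) (Fin 3) ℂ, ∃ s : ℝ, U * Uᴴ = 1 ∧
      (adMat U)ᵀ *ᵥ v = s • Pi.single 7 1 := by
  obtain ⟨k, β, hsq⟩ := hsa.exists_sq_eq
  set V := ∑ i, (v i : ℂ) • tm i with hV
  have hVh : V.IsHermitian := by
    simp [Matrix.IsHermitian, hV, Matrix.conjTranspose_sum, (tm_isHermitian _).eq]
  have hVt : V.trace = 0 := by
    simp [hV, Matrix.trace_sum, trace_tm]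
  have hVc : tCoord V = v := tCoord_sum_smul_tm v
  obtain ⟨U, a, hU, hd⟩ := exists_unitary_conj_diagonal hVh hVt hsq
  have h3 : (√3 : ℂ) ≠ 0 := by
    simp
  refine ⟨U, 2 * √3 * a, hU, ?_⟩
  have hdt : (a : ℂ) • Matrix.diagonal ![1, 1, -2] =
      ∑ i, (((2 * √3 * a) • (Pi.single 7 1 : Fin 8 → ℝ)) i : ℂ) • tm i := by
    rw [Finset.sum_eq_single 7 (fun i _ hi => by simp [hi]) (by simp)]
    ext i j
    fin_cases i <;> fin_cases j <;> simp [tm, gm] <;> field_simp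
  rw [← tCoord_sum_smul_tm ((2 * √3 * a) • (Pi.single 7 1 : Fin 8 → ℝ)), ← hdt, ← hd]
  ext j
  have hc : (tm j * (Uᴴ * V * U)).trace = (U * tm j * Uᴴ * V).trace := by
    rw [← Matrix.mul_assoc, Matrix.trace_mul_comm]
    simp only [Matrix.mul_assoc]
  rw [tCoord, hc, two_re_trace_mul (isHermitian_conj_tm U j)
    (trace_conj_tm (mul_eq_one_comm.mp hU) j), hVc]
  rfl

open Polynomial in
lemma exists_aeval_eq_smul_vecMulVec {Λ : Matrix (Fin 8) (Fin 8) ℝ} (hΛ : Λ.IsSymm) {μ : ℝ}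
    {e : Fin 8 → ℝ} (he0 : e ≠ 0) (he : Λ *ᵥ e = μ • e)
    (hs : ∀ x, Λ *ᵥ x = μ • x → ∃ s : ℝ, x = s • e) :
    ∃ q : ℝ[X], q.natDegree < 8 ∧ ∃ s : ℝ, s ≠ 0 ∧ aeval Λ q = s • Matrix.vecMulVec e e := by
  have hroot : (minpoly ℝ Λ).IsRoot μ := by
    rw [← Matrix.minpoly_toLin']
    apply Module.End.isRoot_of_hasEigenvalue
    exact Module.End.hasEigenvalue_of_hasEigenvector (x := e)
      ⟨Module.End.mem_eigenspace_iff.mpr (by simpa using he), he0⟩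
  obtain ⟨q, hq⟩ := dvd_iff_isRoot.mpr hroot
  have hm0 : minpoly ℝ Λ ≠ 0 := minpoly.ne_zero Λ.isIntegral
  have hq0 : q ≠ 0 := by
    rintro rfl
    exact hm0 (by simpa using hq)
  have hdeg : (minpoly ℝ Λ).natDegree = 1 + q.natDegree := by
    rw [hq, natDegree_mul (X_sub_C_ne_zero μ) hq0, natDegree_X_sub_C]
  have hle : (minpoly ℝ Λ).natDegree ≤ 8 := by
    have := natDegree_le_of_dvd (Matrix.minpoly_dvd_charpoly Λ) Λ.charpoly_monic.ne_zero
    simpa [Matrix.charpoly_natDegree_eq_dim] using this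
  have hP0 : aeval Λ q ≠ 0 := by
    intro h
    have := natDegree_le_of_dvd (minpoly.dvd ℝ Λ h) hq0
    omega
  refine ⟨q, by omega, ?_⟩
  set P := aeval Λ q with hP
  have hmul : Λ * P = μ • P := by
    have h1 := minpoly.aeval ℝ Λ
    rw [hq, map_mul, map_sub, aeval_X, aeval_C, ← hP, sub_mul, sub_eq_zero] at h1
    rw [h1, Algebra.smul_def]
  have hsymm : Pᵀ = P := by
    rw [hP, aeval_eq_sum_range, Matrix.transpose_sum]
    simp [Matrix.transpose_pow, hΛ.eq]
  have hcol (j : Fin 8) : ∃ s : ℝ, P.col j = s • e := by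
    apply hs
    ext i
    simpa [Matrix.mul_apply, mulVec, dotProduct] using congrFun (congrFun hmul i) j
  choose s hs' using hcol
  have hPs (i j : Fin 8) : P i j = s j * e i := congrFun (hs' j) i
  obtain ⟨i₀, hi₀⟩ := Function.ne_iff.mp he0
  have hi₀' : e i₀ ≠ 0 := hi₀
  have hPe : P = (s i₀ / e i₀) • Matrix.vecMulVec e e := by
    ext i j
    have h1 := congrFun (congrFun hsymm i₀) j
    rw [Matrix.transpose_apply, hPs, hPs] at h1
    rw [hPs, Matrix.smul_apply, Matrix.vecMulVec_apply, smul_eq_mul]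
    field_simp
    linear_combination -e i * h1
  refine ⟨_, fun h => hP0 ?_, hPe⟩
  rw [hPe, h, zero_smul]

lemma dContract_sum_smul (N : ℕ) (c : ℕ → ℝ) (S : ℕ → Matrix (Fin 8) (Fin 8) ℝ) (i : Fin 8) :
    dContract (∑ n ∈ Finset.range N, c n • S n) i =
      ∑ n ∈ Finset.range N, c n * dContract (S n) i := by
  induction N with
  | zero => simp [dContract]
  | succ N ih =>
    rw [Finset.sum_range_succ, Finset.sum_range_succ, ← ih]
    simp only [dContract, Matrix.add_apply, Matrix.smul_apply, smul_eq_mul, mul_add,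
      Finset.sum_add_distrib, Finset.mul_sum]
    congr 1
    exact Finset.sum_congr rfl fun j _ => Finset.sum_congr rfl fun k _ => by ring

open Polynomial in
lemma dContract_vecMulVec_eq_zero {Λ : Matrix (Fin 8) (Fin 8) ℝ} (hΛ : Λ.IsSymm) {μ : ℝ}
    {e : Fin 8 → ℝ} (he0 : e ≠ 0) (he : Λ *ᵥ e = μ • e)
    (hs : ∀ x, Λ *ᵥ x = μ • x → ∃ s : ℝ, x = s • e) {i : Fin 8} (h1 : dContract 1 i = 0)
    (hK : ∀ n, 1 ≤ n → n ≤ 7 → Kvec Λ n i = 0) :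
    dContract (Matrix.vecMulVec e e) i = 0 := by
  obtain ⟨q, hq, s, hs0, hP⟩ := exists_aeval_eq_smul_vecMulVec hΛ he0 he hs
  have h : dContract (aeval Λ q) i = 0 := by
    rw [aeval_eq_sum_range' hq, dContract_sum_smul]
    refine Finset.sum_eq_zero fun n hn => ?_
    rcases Nat.eq_zero_or_pos n with rfl | hn0
    · rw [pow_zero, h1, mul_zero]
    · rw [← Kvec_eq, hK n hn0 (by have := Finset.mem_range.mp hn; omega), mul_zero]
  have hsm : dContract (s • Matrix.vecMulVec e e) i = s * dContract (Matrix.vecMulVec e e) i := by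
    simpa using dContract_sum_smul 1 (fun _ => s) (fun _ => Matrix.vecMulVec e e) i
  rw [hP, hsm] at h
  exact (mul_eq_zero.mp h).resolve_left hs0

lemma eq_zero_of_dContract_vecMulVec {e : Fin 8 → ℝ} (h7 : e 7 = 0)
    (h0 : dContract (Matrix.vecMulVec e e) 0 = 0) (h1 : dContract (Matrix.vecMulVec e e) 1 = 0)
    (h2 : dContract (Matrix.vecMulVec e e) 2 = 0) :
    e 3 = 0 ∧ e 4 = 0 ∧ e 5 = 0 ∧ e 6 = 0 := by
  rw [dContract_zero] at h0
  rw [dContract_one] at h1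
  rw [dContract_two] at h2
  simp only [Matrix.vecMulVec_apply, h7, mul_zero, zero_mul, add_zero, zero_add] at h0 h1 h2
  have hP : (e 3 ^ 2 + e 4 ^ 2) ^ 2 = 0 := by
    linear_combination (e 3 * e 5 + e 4 * e 6) * h0 + (e 4 * e 5 - e 3 * e 6) * h1 +
      2 * (e 3 ^ 2 + e 4 ^ 2) * h2
  have hP' := pow_eq_zero_iff (two_ne_zero) |>.mp hP
  have hQ : e 5 ^ 2 + e 6 ^ 2 = 0 := by linear_combination hP' - 2 * h2
  refine ⟨?_, ?_, ?_, ?_⟩ <;> apply pow_eq_zero_iff two_ne_zero |>.mp <;>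
    nlinarith [sq_nonneg (e 3), sq_nonneg (e 4), sq_nonneg (e 5), sq_nonneg (e 6)]

lemma exists_phase {A B G : ℂ} (hAB : normSq A = normSq B)
    (hG : A * (starRingEnd ℂ) G + (starRingEnd ℂ) B * G = 0) :
    ∃ w : ℂ, w * (starRingEnd ℂ) w = 1 ∧ w ^ 2 * B = (starRingEnd ℂ) A ∧
      w ^ 2 * A = (starRingEnd ℂ) B ∧ w ^ 2 * G = -(starRingEnd ℂ) G := by
  have hAB' : A * (starRingEnd ℂ) A = B * (starRingEnd ℂ) B := by
    rw [mul_conj, mul_conj, hAB]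
  obtain ⟨τ, hτ, hB, hGτ⟩ : ∃ τ : ℂ, τ * (starRingEnd ℂ) τ = 1 ∧ τ * B = (starRingEnd ℂ) A ∧
      τ * G = -(starRingEnd ℂ) G := by
    by_cases hG0 : G = 0
    · by_cases hB0 : B = 0
      · refine ⟨1, by simp, ?_, by simp [hG0]⟩
        have : A = 0 := by simpa [hB0] using hAB
        simp [this, hB0]
      · have hB0' : (starRingEnd ℂ) B ≠ 0 := by simpa using hB0
        refine ⟨(starRingEnd ℂ) A / B, ?_, by field_simp, by simp [hG0]⟩
        simp only [map_div₀, conj_conj]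
        field_simp
        linear_combination hAB'
    · have hG0' : (starRingEnd ℂ) G ≠ 0 := by simpa using hG0
      refine ⟨-(starRingEnd ℂ) G / G, ?_, ?_, by field_simp⟩
      · simp only [map_div₀, map_neg, conj_conj]
        field_simp
      · have := congrArg (starRingEnd ℂ) hG
        simp only [map_add, map_mul, conj_conj, map_zero] at this
        field_simp
        linear_combination -this
  obtain ⟨w, rfl⟩ : ∃ w : ℂ, w ^ 2 = τ := ⟨_, Complex.cpow_nat_inv_pow τ two_ne_zero⟩
  have hw : w * (starRingEnd ℂ) w = 1 := by
    rw [mul_conj] at hτ ⊢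
    have h1 : normSq w ^ 2 = 1 := by
      rw [map_pow] at hτ
      exact_mod_cast hτ
    have h2 : normSq w = 1 := (pow_eq_one_iff_of_nonneg (normSq_nonneg w) two_ne_zero).mp h1
    rw [h2, ofReal_one]
  refine ⟨w, hw, hB, ?_, hGτ⟩
  have := congrArg (starRingEnd ℂ) hB
  simp only [map_mul, map_pow, conj_conj] at this
  rw [← this]
  linear_combination (w * (starRingEnd ℂ) w + 1) * (starRingEnd ℂ) B * hw

/-- `Xcp4` twisted by a phase. -/
def phaseCP4 (w : ℂ) : Matrix (Fin 3) (Fin 3) ℂ := !![0, w, 0; -w, 0, 0; 0, 0, 1]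

lemma phaseCP4_mul_conjTranspose {w : ℂ} (hw : w * (starRingEnd ℂ) w = 1) :
    phaseCP4 w * (phaseCP4 w)ᴴ = 1 := by
  ext i j
  fin_cases i <;> fin_cases j <;>
    simp [phaseCP4, Matrix.mul_apply, Fin.sum_univ_three, Matrix.conjTranspose_apply, hw]

lemma phaseCP4_mul_conj {w : ℂ} (hw : w * (starRingEnd ℂ) w = 1) :
    phaseCP4 w * (phaseCP4 w).map (starRingEnd ℂ) = Matrix.diagonal ![-1, -1, 1] := by
  ext i j
  fin_cases i <;> fin_cases j <;>
    simp [phaseCP4, Matrix.mul_apply, Fin.sum_univ_three, hw]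

lemma rVec_explicit (φ : Fin 3 → Fin 2 → ℂ) : rVec φ =
    ![(ip (φ 0) (φ 1)).re, (ip (φ 0) (φ 1)).im, ((ip (φ 0) (φ 0)).re - (ip (φ 1) (φ 1)).re) / 2,
      (ip (φ 0) (φ 2)).re, (ip (φ 0) (φ 2)).im, (ip (φ 1) (φ 2)).re, (ip (φ 1) (φ 2)).im,
      (√3)⁻¹ / 2 * ((ip (φ 0) (φ 0)).re + (ip (φ 1) (φ 1)).re - 2 * (ip (φ 2) (φ 2)).re)] := by
  have hs : ((√3 : ℝ) : ℂ)⁻¹ = (((√3)⁻¹ : ℝ) : ℂ) := by push_cast; rfl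
  have h2 : (2 : ℂ)⁻¹ = ((2⁻¹ : ℝ) : ℂ) := by push_cast; rfl
  ext i
  rw [rVec, rv_eq, trace_tm_mul, hs, h2, re_ofReal_mul]
  generalize (√3)⁻¹ = s
  simp only [gramMat_apply]
  fin_cases i <;> simp [ip, Fin.sum_univ_two] <;> ring

lemma rVec_phaseCP4 {w : ℂ} (hw : w * (starRingEnd ℂ) w = 1) (φ : Fin 3 → Fin 2 → ℂ) :
    rVec (matAct (phaseCP4 w) (conjField φ)) =
    ![-rVec φ 0, -rVec φ 1, -rVec φ 2,
      w.re * rVec φ 5 - w.im * rVec φ 6, -(w.re * rVec φ 6 + w.im * rVec φ 5),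
      -(w.re * rVec φ 3 - w.im * rVec φ 4), w.re * rVec φ 4 + w.im * rVec φ 3, rVec φ 7] := by
  have h1 : w.re ^ 2 + w.im ^ 2 = 1 := by
    have := congrArg Complex.re hw
    simp at this
    linarith
  rw [rVec_explicit, rVec_explicit]
  have e00 : ip (matAct (phaseCP4 w) (conjField φ) 0) (matAct (phaseCP4 w) (conjField φ) 0) =
      (starRingEnd ℂ) (ip (φ 1) (φ 1)) := by
    simp [ip, Fin.sum_univ_three, matAct, conjField, phaseCP4]
    linear_combination (φ 1 0 * (starRingEnd ℂ) (φ 1 0) + φ 1 1 * (starRingEnd ℂ) (φ 1 1)) * hw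
  have e11 : ip (matAct (phaseCP4 w) (conjField φ) 1) (matAct (phaseCP4 w) (conjField φ) 1) =
      (starRingEnd ℂ) (ip (φ 0) (φ 0)) := by
    simp [ip, Fin.sum_univ_three, matAct, conjField, phaseCP4]
    linear_combination (φ 0 0 * (starRingEnd ℂ) (φ 0 0) + φ 0 1 * (starRingEnd ℂ) (φ 0 1)) * hw
  have e22 : ip (matAct (phaseCP4 w) (conjField φ) 2) (matAct (phaseCP4 w) (conjField φ) 2) =
      (starRingEnd ℂ) (ip (φ 2) (φ 2)) := by
    simp [ip, Fin.sum_univ_three, matAct, conjField, phaseCP4]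
  have e01 : ip (matAct (phaseCP4 w) (conjField φ) 0) (matAct (phaseCP4 w) (conjField φ) 1) =
      -ip (φ 0) (φ 1) := by
    simp [ip, Fin.sum_univ_three, matAct, conjField, phaseCP4]
    linear_combination (-(φ 1 0 * (starRingEnd ℂ) (φ 0 0) + φ 1 1 * (starRingEnd ℂ) (φ 0 1))) * hw
  have e02 : ip (matAct (phaseCP4 w) (conjField φ) 0) (matAct (phaseCP4 w) (conjField φ) 2) =
      (starRingEnd ℂ) w * (starRingEnd ℂ) (ip (φ 1) (φ 2)) := by
    simp [ip, Fin.sum_univ_three, matAct, conjField, phaseCP4]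
    ring
  have e12 : ip (matAct (phaseCP4 w) (conjField φ) 1) (matAct (phaseCP4 w) (conjField φ) 2) =
      -((starRingEnd ℂ) w * (starRingEnd ℂ) (ip (φ 0) (φ 2))) := by
    simp [ip, Fin.sum_univ_three, matAct, conjField, phaseCP4]
    ring
  rw [e00, e11, e22, e01, e02, e12]
  ext i
  fin_cases i <;> simp <;> ring

lemma r0_phaseCP4 {w : ℂ} (hw : w * (starRingEnd ℂ) w = 1) (φ : Fin 3 → Fin 2 → ℂ) :
    r0 (matAct (phaseCP4 w) (conjField φ)) = r0 φ := by
  rw [r0_matAct (mul_eq_one_comm.mp (phaseCP4_mul_conjTranspose hw))]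
  simp [r0, ip, conjField, Fin.sum_univ_three, mul_comm]

lemma quadForm_phaseCP4 {Λ : Matrix (Fin 8) (Fin 8) ℝ} (hΛ : Λ.IsSymm)
    (h7 : ∀ i, i ≠ 7 → Λ i 7 = 0)
    (hblock : ∀ j, j = 0 ∨ j = 1 ∨ j = 2 →
      Λ 3 j = 0 ∧ Λ 4 j = 0 ∧ Λ 5 j = 0 ∧ Λ 6 j = 0)
    (h0 : Λ 3 5 + Λ 4 6 = 0) (h1 : Λ 4 5 - Λ 3 6 = 0) (h2 : Λ 3 3 + Λ 4 4 - Λ 5 5 - Λ 6 6 = 0)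
    {w : ℂ} (hw : w * (starRingEnd ℂ) w = 1)
    (hB : w ^ 2 * ⟨(Λ 5 5 - Λ 6 6) / 2, Λ 5 6⟩ = (starRingEnd ℂ) ⟨(Λ 3 3 - Λ 4 4) / 2, Λ 3 4⟩)
    (hA : w ^ 2 * ⟨(Λ 3 3 - Λ 4 4) / 2, Λ 3 4⟩ = (starRingEnd ℂ) ⟨(Λ 5 5 - Λ 6 6) / 2, Λ 5 6⟩)
    (hG : w ^ 2 * ⟨Λ 3 5, Λ 3 6⟩ = -(starRingEnd ℂ) ⟨Λ 3 5, Λ 3 6⟩) (r : Fin 8 → ℝ) :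
    let r' : Fin 8 → ℝ := ![-r 0, -r 1, -r 2, w.re * r 5 - w.im * r 6,
      -(w.re * r 6 + w.im * r 5), -(w.re * r 3 - w.im * r 4), w.re * r 4 + w.im * r 3, r 7]
    r' ⬝ᵥ Λ *ᵥ r' = r ⬝ᵥ Λ *ᵥ r := by
  intro r'
  have hexp (x : Fin 8 → ℝ) : x ⬝ᵥ Λ *ᵥ x =
      Λ 0 0 * x 0 ^ 2 + Λ 1 1 * x 1 ^ 2 + Λ 2 2 * x 2 ^ 2 + 2 * Λ 0 1 * x 0 * x 1 +
      2 * Λ 0 2 * x 0 * x 2 + 2 * Λ 1 2 * x 1 * x 2 + Λ 7 7 * x 7 ^ 2 +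
      (Λ 3 3 + Λ 4 4) / 2 * (x 3 ^ 2 + x 4 ^ 2 + x 5 ^ 2 + x 6 ^ 2) +
      (Λ 3 3 - Λ 4 4) / 2 * (x 3 ^ 2 - x 4 ^ 2) + 2 * Λ 3 4 * x 3 * x 4 +
      (Λ 5 5 - Λ 6 6) / 2 * (x 5 ^ 2 - x 6 ^ 2) + 2 * Λ 5 6 * x 5 * x 6 +
      2 * Λ 3 5 * (x 3 * x 5 - x 4 * x 6) + 2 * Λ 3 6 * (x 3 * x 6 + x 4 * x 5) := by
    obtain ⟨a1, a2, a3, a4⟩ := hblock 0 (by simp)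
    obtain ⟨b1, b2, b3, b4⟩ := hblock 1 (by simp)
    obtain ⟨c1, c2, c3, c4⟩ := hblock 2 (by simp)
    have hs := fun i j => hΛ.apply i j
    simp only [dotProduct, mulVec, Fin.sum_univ_eight]
    simp only [hs 0 1, hs 0 2, hs 1 2, hs 3 0, hs 4 0, hs 5 0, hs 6 0, hs 3 1, hs 4 1, hs 5 1, hs 6 1, hs 3 2,
      hs 4 2,
      hs 5 2, hs 6 2, a1, a2, a3, a4, b1, b2, b3, b4, c1, c2, c3, c4, hs 0 7, hs 1 7, hs 2 7,
      hs 3 7, hs 4 7, hs 5 7, hs 6 7, hs 3 4, hs 3 5, hs 3 6, hs 4 5, hs 4 6, hs 5 6,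
      h7 0 (by decide), h7 1 (by decide), h7 2 (by decide), h7 3 (by decide), h7 4 (by decide),
      h7 5 (by decide), h7 6 (by decide)]
    linear_combination -(x 5 ^ 2 + x 6 ^ 2) / 2 * h2 + 2 * x 4 * x 6 * h0 + 2 * x 4 * x 5 * h1
  have hw1 : w.re ^ 2 + w.im ^ 2 = 1 := by
    have := congrArg Complex.re hw
    simp at this
    linarith
  simp only [Complex.ext_iff, pow_two, mul_re, mul_im, conj_re, conj_im, neg_re, neg_im]
    at hB hA hG
  rw [hexp r', hexp r]
  have e0 : r' 0 = -r 0 := rfl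
  have e1 : r' 1 = -r 1 := rfl
  have e2 : r' 2 = -r 2 := rfl
  have e3 : r' 3 = w.re * r 5 - w.im * r 6 := rfl
  have e4 : r' 4 = -(w.re * r 6 + w.im * r 5) := rfl
  have e5 : r' 5 = -(w.re * r 3 - w.im * r 4) := rfl
  have e6 : r' 6 = w.re * r 4 + w.im * r 3 := rfl
  have e7 : r' 7 = r 7 := rfl
  rw [e0, e1, e2, e3, e4, e5, e6, e7]
  linear_combination
    (Λ 3 3 + Λ 4 4) / 2 * (r 3 ^ 2 + r 4 ^ 2 + r 5 ^ 2 + r 6 ^ 2) * hw1 +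
    (r 3 ^ 2 - r 4 ^ 2) * hB.1 - 2 * r 3 * r 4 * hB.2 +
    (r 5 ^ 2 - r 6 ^ 2) * hA.1 - 2 * r 5 * r 6 * hA.2 -
    2 * (r 3 * r 5 - r 4 * r 6) * hG.1 + 2 * (r 3 * r 6 + r 4 * r 5) * hG.2

lemma hasCP4_of_block {M0 Λ0 : ℝ} {M L : Fin 8 → ℝ} {Λ : Matrix (Fin 8) (Fin 8) ℝ}
    (hΛ : Λ.IsSymm) (hM : ∀ i, i ≠ 7 → M i = 0) (hL : ∀ i, i ≠ 7 → L i = 0)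
    (h7 : ∀ i, i ≠ 7 → Λ i 7 = 0)
    (hblock : ∀ j, j = 0 ∨ j = 1 ∨ j = 2 →
      Λ 3 j = 0 ∧ Λ 4 j = 0 ∧ Λ 5 j = 0 ∧ Λ 6 j = 0)
    (hK : ∀ i : Fin 8, i = 0 ∨ i = 1 ∨ i = 2 → ∀ n, 1 ≤ n → n ≤ 7 → Kvec Λ n i = 0) :
    HasCP4 M0 Λ0 M L Λ := by
  have hs := fun i j => hΛ.apply i j
  obtain ⟨a1, a2, a3, a4⟩ := hblock 0 (by simp)
  obtain ⟨b1, b2, b3, b4⟩ := hblock 1 (by simp)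
  obtain ⟨c1, c2, c3, c4⟩ := hblock 2 (by simp)
  have hz := h7 3 (by decide)
  have hz' := h7 4 (by decide)
  have hz'' := h7 5 (by decide)
  have hz''' := h7 6 (by decide)
  have k0 := hK 0 (by simp) 1 (by norm_num) (by norm_num)
  have k1 := hK 1 (by simp) 1 (by norm_num) (by norm_num)
  have k2 := hK 2 (by simp) 1 (by norm_num) (by norm_num)
  have l0 := hK 0 (by simp) 2 (by norm_num) (by norm_num)
  have l1 := hK 1 (by simp) 2 (by norm_num) (by norm_num)
  have l2 := hK 2 (by simp) 2 (by norm_num) (by norm_num)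
  rw [Kvec_eq] at k0 k1 k2 l0 l1 l2
  rw [pow_one] at k0 k1 k2
  rw [pow_two] at l0 l1 l2
  rw [dContract_zero] at k0 l0
  rw [dContract_one] at k1 l1
  rw [dContract_two] at k2 l2
  simp only [Matrix.mul_apply, Fin.sum_univ_eight, hs 0 1, hs 0 2, hs 1 2, hs 3 0, hs 4 0, hs 5 0,
    hs 6 0, hs 3 1, hs 4 1, hs 5 1, hs 6 1, hs 3 2, hs 4 2, hs 5 2, hs 6 2, a1, a2, a3, a4, b1, b2,
    b3, b4, c1, c2, c3, c4, hs 0 7, hs 1 7, hs 2 7, hs 3 7, hs 4 7, hs 5 7, hs 6 7, hs 3 4, hs 3 5,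
    hs 3 6, hs 4 5, hs 4 6, hs 5 6, h7 0 (by decide), h7 1 (by decide), h7 2 (by decide), hz, hz',
    hz'', hz''', mul_zero, zero_mul, add_zero, zero_add] at k0 k1 k2 l0 l1 l2
  have h0 : Λ 3 5 + Λ 4 6 = 0 := by linear_combination k0
  have h1 : Λ 4 5 - Λ 3 6 = 0 := by linear_combination k1
  have h2 : Λ 3 3 + Λ 4 4 - Λ 5 5 - Λ 6 6 = 0 := by linear_combination 2 * k2
  have h46 : Λ 4 6 = -Λ 3 5 := by linarith
  have h45 : Λ 4 5 = Λ 3 6 := by linarith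
  have h66 : Λ 6 6 = Λ 3 3 + Λ 4 4 - Λ 5 5 := by linarith
  rw [h46, h45, h66] at l0 l1 l2
  have hAB : normSq ⟨(Λ 3 3 - Λ 4 4) / 2, Λ 3 4⟩ = normSq ⟨(Λ 5 5 - Λ 6 6) / 2, Λ 5 6⟩ := by
    rw [normSq_mk, normSq_mk, h66]
    linear_combination l2
  have hG : (⟨(Λ 3 3 - Λ 4 4) / 2, Λ 3 4⟩ : ℂ) * (starRingEnd ℂ) ⟨Λ 3 5, Λ 3 6⟩ +
      (starRingEnd ℂ) ⟨(Λ 5 5 - Λ 6 6) / 2, Λ 5 6⟩ * ⟨Λ 3 5, Λ 3 6⟩ = 0 := by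
    apply Complex.ext
    · simp [h66]
      linear_combination l0 / 2
    · simp [h66]
      linear_combination l1 / 2
  obtain ⟨w, hw, hwB, hwA, hwG⟩ := exists_phase hAB hG
  refine ⟨phaseCP4 w, phaseCP4_mul_conjTranspose hw, ?_, ?_, fun φ => ?_⟩
  · rw [phaseCP4_mul_conj hw]
    intro h
    have := congrFun (congrFun h 0) 0
    norm_num at this
  · rw [phaseCP4_mul_conj hw, pow_two, Matrix.diagonal_mul_diagonal, ← Matrix.diagonal_one]
    congr 1
    ext i
    fin_cases i <;> simp
  · change pot M0 Λ0 M L Λ (matAct (phaseCP4 w) (conjField φ)) = _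
    have hdot {N : Fin 8 → ℝ} (hN : ∀ i, i ≠ 7 → N i = 0) (x : Fin 8 → ℝ) :
        N ⬝ᵥ x = N 7 * x 7 :=
      Finset.sum_eq_single 7 (fun i _ hi => by rw [hN i hi, zero_mul]) (by simp)
    rw [pot_eq, pot_eq, r0_phaseCP4 hw, rVec_phaseCP4 hw,
      quadForm_phaseCP4 hΛ h7 hblock h0 h1 h2 hw hwB hwA hwG, hdot hM, hdot hM, hdot hL, hdot hL]
    rfl

lemma hasCP4_of_standard {M0 Λ0 : ℝ} {M L : Fin 8 → ℝ} {Λ : Matrix (Fin 8) (Fin 8) ℝ}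
    (hΛ : Λ.IsSymm) (hM : ∀ i, i ≠ 7 → M i = 0) (hL : ∀ i, i ≠ 7 → L i = 0)
    (h7 : ∀ i, i ≠ 7 → Λ i 7 = 0)
    (hK : ∀ i : Fin 8, i ≠ 7 → ∀ n, 1 ≤ n → n ≤ 7 → Kvec Λ n i = 0)
    {μ : Fin 4 → ℝ} (hμ : Function.Injective μ) {e : Fin 4 → Fin 8 → ℝ} (he0 : ∀ a, e a ≠ 0)
    (he : ∀ a, Λ *ᵥ e a = μ a • e a)
    (hs : ∀ a x, Λ *ᵥ x = μ a • x → ∃ s : ℝ, x = s • e a) :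
    HasCP4 M0 Λ0 M L Λ := by
  obtain ⟨ι, hι, hne⟩ : ∃ ι : Fin 3 → Fin 4, Function.Injective ι ∧ ∀ a, μ (ι a) ≠ Λ 7 7 := by
    by_cases h : ∃ a, μ a = Λ 7 7
    · obtain ⟨a, ha⟩ := h
      refine ⟨a.succAbove, Fin.succAbove_right_injective, fun b hb => ?_⟩
      exact Fin.succAbove_ne a b (hμ (hb.trans ha.symm))
    · push Not at h
      exact ⟨Fin.castSucc, Fin.castSucc_injective 3, fun a => h _⟩
  have hcomp (a : Fin 4) (i : Fin 8) : ∑ j, Λ i j * e a j = μ a * e a i := by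
    simpa [mulVec, dotProduct] using congrFun (he a) i
  have he7 (a : Fin 3) : e (ι a) 7 = 0 := by
    have h1 := hcomp (ι a) 7
    rw [Finset.sum_eq_single 7 (fun j _ hj => by rw [hΛ.apply, h7 j hj, zero_mul])
      (by simp)] at h1
    have h2 : (μ (ι a) - Λ 7 7) * e (ι a) 7 = 0 := by linear_combination -h1
    exact (mul_eq_zero.mp h2).resolve_left (sub_ne_zero.mpr (hne a))
  have hd1 : dContract 1 0 = 0 ∧ dContract 1 1 = 0 ∧ dContract 1 2 = 0 := by
    rw [dContract_zero, dContract_one, dContract_two]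
    simp
  have hez (a : Fin 3) : e (ι a) 3 = 0 ∧ e (ι a) 4 = 0 ∧ e (ι a) 5 = 0 ∧ e (ι a) 6 = 0 := by
    apply eq_zero_of_dContract_vecMulVec (he7 a)
    · exact dContract_vecMulVec_eq_zero hΛ (he0 _) (he _) (hs _) hd1.1 (hK 0 (by decide))
    · exact dContract_vecMulVec_eq_zero hΛ (he0 _) (he _) (hs _) hd1.2.1 (hK 1 (by decide))
    · exact dContract_vecMulVec_eq_zero hΛ (he0 _) (he _) (hs _) hd1.2.2 (hK 2 (by decide))
  have horth {a b : Fin 3} (hab : a ≠ b) : e (ι a) ⬝ᵥ e (ι b) = 0 := by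
    have h1 : e (ι a) ⬝ᵥ Λ *ᵥ e (ι b) = (Λ *ᵥ e (ι a)) ⬝ᵥ e (ι b) := by
      rw [Matrix.dotProduct_mulVec, ← Matrix.mulVec_transpose, hΛ.eq]
    rw [he, he, dotProduct_smul, smul_dotProduct, smul_eq_mul, smul_eq_mul] at h1
    have h2 : (μ (ι b) - μ (ι a)) * (e (ι a) ⬝ᵥ e (ι b)) = 0 := by linear_combination h1
    exact (mul_eq_zero.mp h2).resolve_left
      (sub_ne_zero.mpr fun h => hab (hι (hμ h)).symm)
  have hdot3 (x : Fin 8 → ℝ) (a : Fin 3) :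
      e (ι a) ⬝ᵥ x = e (ι a) 0 * x 0 + e (ι a) 1 * x 1 + e (ι a) 2 * x 2 := by
    obtain ⟨z3, z4, z5, z6⟩ := hez a
    simp [dotProduct, Fin.sum_univ_eight, z3, z4, z5, z6, he7 a]
  set N : Matrix (Fin 3) (Fin 3) ℝ :=
    Matrix.of fun a => ![e (ι a) 0, e (ι a) 1, e (ι a) 2] with hN
  have hNN : N * Nᵀ = Matrix.diagonal fun a => e (ι a) ⬝ᵥ e (ι a) := by
    ext a b
    have h1 : (N * Nᵀ) a b = e (ι a) ⬝ᵥ e (ι b) := by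
      rw [hdot3, Matrix.mul_apply, Fin.sum_univ_three]
      rfl
    rw [h1]
    by_cases hab : a = b
    · rw [hab, Matrix.diagonal_apply_eq]
    · rw [Matrix.diagonal_apply_ne _ hab, horth hab]
  have hdet : N.det ≠ 0 := by
    intro h
    have h1 := congrArg Matrix.det hNN
    rw [Matrix.det_mul, h, zero_mul, Matrix.det_diagonal] at h1
    exact Finset.prod_ne_zero_iff.mpr
      (fun a _ => dotProduct_self_eq_zero.not.mpr (he0 (ι a))) h1.symm
  have hrow (i : Fin 8) (hi : ∀ a, e (ι a) i = 0) : Λ i 0 = 0 ∧ Λ i 1 = 0 ∧ Λ i 2 = 0 := by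
    have h1 : N *ᵥ ![Λ i 0, Λ i 1, Λ i 2] = 0 := by
      ext a
      have h2 := hcomp (ι a) i
      rw [hi a, mul_zero] at h2
      have h3 := hdot3 (Λ i) a
      rw [dotProduct_comm, dotProduct, h2] at h3
      simpa [hN, mulVec, dotProduct, Fin.sum_univ_three] using h3.symm
    have h4 := Matrix.eq_zero_of_mulVec_eq_zero hdet h1
    exact ⟨congrFun h4 0, congrFun h4 1, congrFun h4 2⟩
  have r3 := hrow 3 fun a => (hez a).1
  have r4 := hrow 4 fun a => (hez a).2.1
  have r5 := hrow 5 fun a => (hez a).2.2.1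
  have r6 := hrow 6 fun a => (hez a).2.2.2
  refine hasCP4_of_block hΛ hM hL h7 ?_ fun i hi =>
    hK i (by rcases hi with rfl | rfl | rfl <;> decide)
  rintro j (rfl | rfl | rfl)
  · exact ⟨r3.1, r4.1, r5.1, r6.1⟩
  · exact ⟨r3.2.1, r4.2.1, r5.2.1, r6.2.1⟩
  · exact ⟨r3.2.2, r4.2.2, r5.2.2, r6.2.2⟩

lemma exists_eigenvector_of_finrank_eq_one {n : Type*} [Fintype n] [DecidableEq n]
    {Λ : Matrix n n ℝ} {μ : ℝ}
    (h : Module.finrank ℝ (Module.End.eigenspace (Matrix.toLin' Λ) μ) = 1) :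
    ∃ e : n → ℝ, e ≠ 0 ∧ Λ *ᵥ e = μ • e ∧ ∀ x, Λ *ᵥ x = μ • x → ∃ s : ℝ, x = s • e := by
  obtain ⟨⟨e, he⟩, he0, hs⟩ := finrank_eq_one_iff'.mp h
  refine ⟨e, fun h => he0 (Subtype.ext h), by simpa using Module.End.mem_eigenspace_iff.mp he,
    fun x hx => ?_⟩
  obtain ⟨c, hc⟩ := hs ⟨x, Module.End.mem_eigenspace_iff.mpr (by simpa using hx)⟩
  exact ⟨c, (congrArg Subtype.val hc).symm⟩

/-- **Theorem 2 (generic CP4).** If there is a nonzero self-aligned eigenvector `v` of the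
symmetric matrix `Λ` such that `M`, `L` and all `K⁽ⁿ⁾` for `1 ≤ n ≤ 7` are real multiples of
`v` (at least one of them nonzero), and `Λ` has at least four eigenvalues of multiplicity one,
then the potential admits a CP symmetry of order 4. -/
theorem generic_cp4
    (M0 Λ0 : ℝ) (M L : Fin 8 → ℝ) (Λ : Matrix (Fin 8) (Fin 8) ℝ) (hΛ : Λ.IsSymm)
    (v : Fin 8 → ℝ) (hv : v ≠ 0) (hsa : SelfAligned v)
    (heig : ∃ μ : ℝ, Λ.mulVec v = μ • v)
    (hM : ∃ c : ℝ, M = c • v) (hL : ∃ c : ℝ, L = c • v)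
    (hK : ∀ n : ℕ, 1 ≤ n → n ≤ 7 → ∃ c : ℝ, Kvec Λ n = c • v)
    (hnz : M ≠ 0 ∨ L ≠ 0 ∨ ∃ n : ℕ, 1 ≤ n ∧ n ≤ 7 ∧ Kvec Λ n ≠ 0)
    (hfour : ∃ μ1 μ2 μ3 μ4 : ℝ,
      μ1 ≠ μ2 ∧ μ1 ≠ μ3 ∧ μ1 ≠ μ4 ∧ μ2 ≠ μ3 ∧ μ2 ≠ μ4 ∧ μ3 ≠ μ4 ∧
      Module.finrank ℝ (Module.End.eigenspace (Matrix.toLin' Λ) μ1) = 1 ∧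
      Module.finrank ℝ (Module.End.eigenspace (Matrix.toLin' Λ) μ2) = 1 ∧
      Module.finrank ℝ (Module.End.eigenspace (Matrix.toLin' Λ) μ3) = 1 ∧
      Module.finrank ℝ (Module.End.eigenspace (Matrix.toLin' Λ) μ4) = 1) :
    HasCP4 M0 Λ0 M L Λ := by
  obtain ⟨U, s, hU, hOv⟩ := hsa.exists_adMat
  set O := adMat U with hO
  have hOO : O * Oᵀ = 1 := adMat_mul_transpose hU
  have hOO' : Oᵀ * O = 1 := mul_eq_one_comm.mp hOO
  have hinv (x : Fin 8 → ℝ) : O *ᵥ Oᵀ *ᵥ x = x := by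
    rw [Matrix.mulVec_mulVec, hOO, Matrix.one_mulVec]
  have hinv' (x : Fin 8 → ℝ) : Oᵀ *ᵥ O *ᵥ x = x := by
    rw [Matrix.mulVec_mulVec, hOO', Matrix.one_mulVec]
  have hs0 : s ≠ 0 := by
    rintro rfl
    apply hv
    rw [← hinv v, hOv, zero_smul, Matrix.mulVec_zero]
  have hvec {x : Fin 8 → ℝ} (hx : ∃ c : ℝ, x = c • v) (i : Fin 8) (hi : i ≠ 7) :
      (Oᵀ *ᵥ x) i = 0 := by
    obtain ⟨c, rfl⟩ := hx
    rw [Matrix.mulVec_smul, hOv]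
    simp [hi]
  have hact (x : Fin 8 → ℝ) : (Oᵀ * Λ * O) *ᵥ x = Oᵀ *ᵥ Λ *ᵥ O *ᵥ x := by
    rw [Matrix.mulVec_mulVec, Matrix.mulVec_mulVec]
  have hfam : ∃ μ : Fin 4 → ℝ, Function.Injective μ ∧
      ∀ a, Module.finrank ℝ (Module.End.eigenspace (Matrix.toLin' Λ) (μ a)) = 1 := by
    obtain ⟨μ1, μ2, μ3, μ4, h12, h13, h14, h23, h24, h34, f1, f2, f3, f4⟩ := hfour
    refine ⟨![μ1, μ2, μ3, μ4], fun a b hab => ?_, fun a => ?_⟩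
    · fin_cases a <;> fin_cases b <;> simp_all
    · fin_cases a <;> assumption
  obtain ⟨μ, hμ, hfr⟩ := hfam
  choose e he0 he hs using fun a => exists_eigenvector_of_finrank_eq_one (hfr a)
  refine HasCP4.of_adMat hU (hasCP4_of_standard (e := fun a => Oᵀ *ᵥ e a) ?_ (hvec hM) (hvec hL)
    ?_ ?_ hμ ?_ ?_ ?_)
  · rw [Matrix.IsSymm, Matrix.transpose_mul, Matrix.transpose_mul, Matrix.transpose_transpose,
      hΛ.eq, Matrix.mul_assoc]
  · intro i hi
    obtain ⟨ν, hν⟩ := heig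
    have h1 : (Oᵀ * Λ * O) *ᵥ (Pi.single 7 1 : Fin 8 → ℝ) = ν • Pi.single 7 1 := by
      have h2 : (Pi.single 7 1 : Fin 8 → ℝ) = s⁻¹ • Oᵀ *ᵥ v := by
        rw [hOv, smul_smul, inv_mul_cancel₀ hs0, one_smul]
      rw [h2, Matrix.mulVec_smul, hact, hinv, hν, Matrix.mulVec_smul, smul_comm]
    have h3 := congrFun h1 i
    simpa [hi] using h3
  · intro i hi n h1 h7
    rw [Kvec_conj hU]
    exact hvec (hK n h1 h7) i hi
  · intro a h
    apply he0 a
    rw [← hinv (e a), h, Matrix.mulVec_zero]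
  · intro a
    rw [hact, hinv, he, Matrix.mulVec_smul]
  · intro a x hx
    rw [hact] at hx
    have h1 : Λ *ᵥ (O *ᵥ x) = μ a • O *ᵥ x := by
      rw [← hinv (Λ *ᵥ O *ᵥ x), hx, Matrix.mulVec_smul]
    obtain ⟨c, hc⟩ := hs a _ h1
    exact ⟨c, by rw [← hinv' x, hc, Matrix.mulVec_smul]⟩
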